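/- arXiv:1208.6228 — 3 statements merged into one kernel-verified Lean document; each statement's English description precedes it below -/
import Mathlib

section
/- For all s₀, t with b ≤ s₀ ≤ t ≤ c, one has ∫_{s₀}^{t} H₄(σ) dσ = H₄*(t) − H₄*(s₀), where H₄(s) = (a+b) + Θ₆s/4 + (b/(2a))·s·arcsin(a/s) + (b/2)·√(1 − (a/s)²) + (a/(2b))·s·arcsin(b/s) + (a/2)·√(1 − (b/s)²) and H₄*(t) = (a+b)·t + Θ₆t²/8 + (b/(2a))·L₁*(t,a) + (b/2)·L₂*(t,a) + (a/(2b))·L₁*(t,b) + (a/2)·L₂*(t,b) with L₁*(t,r) = (1/2)(r√(t²−r²) + t²·arcsin(r/t)) and L₂*(t,r) = √(t²−r²) + r·arcsin(r/t). -/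
open Real MeasureTheory

theorem sqrt_one_sub_div_sq {r x : ℝ} (hx : 0 < x) :
    √(1 - (r / x) ^ 2) = √(x ^ 2 - r ^ 2) / x := by
  have h : 1 - (r / x) ^ 2 = (x ^ 2 - r ^ 2) / x ^ 2 := by field_simp
  rw [h, Real.sqrt_div' _ (sq_nonneg x), Real.sqrt_sq hx.le]

theorem hasDerivAt_sqrt_sq_sub_sq {r x : ℝ} (hr : 0 < r) (hrx : r < x) :
    HasDerivAt (fun y => √(y ^ 2 - r ^ 2)) (x / √(x ^ 2 - r ^ 2)) x := by
  have hpos : 0 < x ^ 2 - r ^ 2 := by nlinarith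
  have h := ((hasDerivAt_pow 2 x).sub_const (r ^ 2)).sqrt hpos.ne'
  refine h.congr_deriv ?_
  have := (Real.sqrt_pos.2 hpos).ne'
  field_simp
  norm_num [mul_comm]

theorem hasDerivAt_arcsin_div {r x : ℝ} (hr : 0 < r) (hrx : r < x) :
    HasDerivAt (fun y => Real.arcsin (r / y)) (-r / (x * √(x ^ 2 - r ^ 2))) x := by
  have hx : 0 < x := hr.trans hrx
  have hpos : 0 < x ^ 2 - r ^ 2 := by nlinarith
  have hlt : r / x < 1 := (div_lt_one hx).2 hrx
  have hgt : 0 < r / x := div_pos hr hx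
  have hd : HasDerivAt (fun y : ℝ => r / y) (-r / x ^ 2) x := by
    simpa [div_eq_mul_inv] using (hasDerivAt_inv hx.ne').const_mul r
  have h := (Real.hasDerivAt_arcsin (x := r / x) (by linarith) hlt.ne).comp x hd
  refine h.congr_deriv ?_
  rw [sqrt_one_sub_div_sq hx]
  have := (Real.sqrt_pos.2 hpos).ne'
  field_simp

theorem hasDerivAt_half_mul_sqrt_add_sq_mul_arcsin {r x : ℝ} (hr : 0 < r) (hrx : r < x) :
    HasDerivAt (fun y => (1 / 2) * (r * √(y ^ 2 - r ^ 2) + y ^ 2 * Real.arcsin (r / y)))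
      (x * Real.arcsin (r / x)) x := by
  have hx : 0 < x := hr.trans hrx
  have hpos : 0 < x ^ 2 - r ^ 2 := by nlinarith
  have h := (((hasDerivAt_sqrt_sq_sub_sq hr hrx).const_mul r).add
    ((hasDerivAt_pow 2 x).mul (hasDerivAt_arcsin_div hr hrx))).const_mul (1 / 2)
  refine h.congr_deriv ?_
  have := (Real.sqrt_pos.2 hpos).ne'
  field_simp
  ring

theorem hasDerivAt_sqrt_add_mul_arcsin {r x : ℝ} (hr : 0 < r) (hrx : r < x) :
    HasDerivAt (fun y => √(y ^ 2 - r ^ 2) + r * Real.arcsin (r / y))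
      √(1 - (r / x) ^ 2) x := by
  have hx : 0 < x := hr.trans hrx
  have hpos : 0 < x ^ 2 - r ^ 2 := by nlinarith
  have h := (hasDerivAt_sqrt_sq_sub_sq hr hrx).add
    ((hasDerivAt_arcsin_div hr hrx).const_mul r)
  refine h.congr_deriv ?_
  rw [sqrt_one_sub_div_sq hx]
  have := (Real.sqrt_pos.2 hpos).ne'
  field_simp
  rw [Real.sq_sqrt hpos.le]
  ring

theorem continuousOn_arcsin_div (r : ℝ) {s : Set ℝ} (hs : ∀ x ∈ s, x ≠ 0) :
    ContinuousOn (fun y => Real.arcsin (r / y)) s :=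
  Real.continuous_arcsin.comp_continuousOn (continuousOn_const.div continuousOn_id hs)

/-- The antiderivative `H₄*` of `H₄` on `[b, c]`. -/
theorem integral_H4
    (a b c α : ℝ) (ha : 0 < a) (hab : a ≤ b)
    (hc : c = Real.sqrt (a ^ 2 + b ^ 2))
    (hα : α = Real.arctan (a / b))
    (Θ₆ : ℝ)
    (hΘ₆ : Θ₆ = (a / b) * (2 * α - π) - (2 * b / a) * α + 2)
    (L₁s L₂s : ℝ → ℝ → ℝ)
    (hL₁s : ∀ t r, L₁s t r = (1 / 2) * (r * Real.sqrt (t ^ 2 - r ^ 2)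
      + t ^ 2 * Real.arcsin (r / t)))
    (hL₂s : ∀ t r, L₂s t r = Real.sqrt (t ^ 2 - r ^ 2) + r * Real.arcsin (r / t))
    (H₄ H₄s : ℝ → ℝ)
    (hH₄ : ∀ s, H₄ s = (a + b) + Θ₆ * s / 4
      + (b / (2 * a)) * (s * Real.arcsin (a / s))
      + (b / 2) * Real.sqrt (1 - (a / s) ^ 2)
      + (a / (2 * b)) * (s * Real.arcsin (b / s))
      + (a / 2) * Real.sqrt (1 - (b / s) ^ 2))
    (hH₄s : ∀ t, H₄s t = (a + b) * t + Θ₆ * t ^ 2 / 8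
      + (b / (2 * a)) * L₁s t a + (b / 2) * L₂s t a
      + (a / (2 * b)) * L₁s t b + (a / 2) * L₂s t b) :
    ∀ s₀ t : ℝ, b ≤ s₀ → s₀ ≤ t → t ≤ c →
      (∫ σ in s₀..t, H₄ σ) = H₄s t - H₄s s₀ := by
  intro s₀ t hb hst _
  have hne : ∀ x ∈ Set.Icc s₀ t, x ≠ 0 := fun x hx => by linarith [hx.1]
  have hdiv : ∀ r : ℝ, ContinuousOn (fun y => r / y) (Set.Icc s₀ t) := fun r =>
    continuousOn_const.div continuousOn_id hne
  have harc : ∀ r : ℝ, ContinuousOn (fun y => Real.arcsin (r / y)) (Set.Icc s₀ t) :=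
    fun r => continuousOn_arcsin_div r hne
  obtain rfl := funext hH₄
  obtain rfl := funext hH₄s
  simp only [hL₁s, hL₂s]
  have hda := hdiv a
  have hdb := hdiv b
  have haa := harc a
  have hab' := harc b
  refine intervalIntegral.integral_eq_sub_of_hasDerivAt_of_le (f := fun t =>
    (a + b) * t + Θ₆ * t ^ 2 / 8
      + (b / (2 * a)) * ((1 / 2) * (a * √(t ^ 2 - a ^ 2) + t ^ 2 * Real.arcsin (a / t)))
      + (b / 2) * (√(t ^ 2 - a ^ 2) + a * Real.arcsin (a / t))
      + (a / (2 * b)) * ((1 / 2) * (b * √(t ^ 2 - b ^ 2) + t ^ 2 * Real.arcsin (b / t)))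
      + (a / 2) * (√(t ^ 2 - b ^ 2) + b * Real.arcsin (b / t)))
    hst (by fun_prop) (fun x hx => ?_) ?_
  · have hbx : b < x := hb.trans_lt hx.1
    have hax : a < x := hab.trans_lt hbx
    have hb0 : 0 < b := ha.trans_le hab
    have hlin := ((hasDerivAt_id x).const_mul (a + b)).add
      (((hasDerivAt_pow 2 x).const_mul Θ₆).div_const 8)
    have h := (((hlin.add
      ((hasDerivAt_half_mul_sqrt_add_sq_mul_arcsin ha hax).const_mul (b / (2 * a)))).add
      ((hasDerivAt_sqrt_add_mul_arcsin ha hax).const_mul (b / 2))).add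
      ((hasDerivAt_half_mul_sqrt_add_sq_mul_arcsin hb0 hbx).const_mul (a / (2 * b)))).add
      ((hasDerivAt_sqrt_add_mul_arcsin hb0 hbx).const_mul (a / 2))
    refine h.congr_deriv ?_
    norm_num
    ring
  · apply ContinuousOn.intervalIntegrable
    rw [Set.uIcc_of_le hst]
    fun_prop
end

section
/- For every t with 0 ≤ t < c, the four-dimensional Lebesgue measure of the set {(P,Q) ∈ R × R : ‖P − Q‖ ≤ t} equals 2·J_R°(t), and it equals (ab)² for t ≥ c. (Equivalently, the distribution function of the distance between two independent uniformly distributed random points in the rectangle R is G_R(t) = 2·J_R°(t)/A_R² for 0 ≤ t < c.) -/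
open Real MeasureTheory

open Set

/-- Coordinates pairing turns pairs of planar points into a pair of coordinate pairs. -/
theorem volume_euclideanSpace_prod_eq (S : Set ((ℝ × ℝ) × (ℝ × ℝ))) (hS : MeasurableSet S) :
    volume {PQ : EuclideanSpace ℝ (Fin 2) × EuclideanSpace ℝ (Fin 2) |
      ((PQ.1 0, PQ.2 0), (PQ.1 1, PQ.2 1)) ∈ S} = volume S := by
  have h1 : MeasurePreserving
      (Prod.map (@WithLp.ofLp 2 (Fin 2 → ℝ)) (@WithLp.ofLp 2 (Fin 2 → ℝ)))
      (volume : Measure (EuclideanSpace ℝ (Fin 2) × EuclideanSpace ℝ (Fin 2))) volume :=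
    (PiLp.volume_preserving_ofLp (Fin 2)).prod (PiLp.volume_preserving_ofLp (Fin 2))
  have h2 : MeasurePreserving (MeasurableEquiv.arrowProdEquivProdArrow ℝ ℝ (Fin 2)).symm :=
    (volume_measurePreserving_arrowProdEquivProdArrow ℝ ℝ (Fin 2)).symm
  exact ((volume_preserving_finTwoArrow (ℝ × ℝ)).comp (h2.comp h1)).measure_preimage
    hS.nullMeasurableSet

theorem integral_min_left {b s : ℝ} (hs : 0 ≤ s) (hsb : s ≤ b) :
    ∫ p in (0:ℝ)..b, min s p = b * s - s ^ 2 / 2 := by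
  have hc : Continuous fun p : ℝ => min s p := by fun_prop
  rw [← intervalIntegral.integral_add_adjacent_intervals (b := s)
    (hc.intervalIntegrable _ _) (hc.intervalIntegrable _ _)]
  have e1 : ∫ p in (0:ℝ)..s, min s p = ∫ p in (0:ℝ)..s, p := by
    refine intervalIntegral.integral_congr fun p hp => ?_
    rw [uIcc_of_le hs] at hp
    exact min_eq_right hp.2
  have e2 : ∫ p in s..b, min s p = ∫ p in s..b, s := by
    refine intervalIntegral.integral_congr fun p hp => ?_
    rw [uIcc_of_le hsb] at hp
    exact min_eq_left hp.1
  rw [e1, e2, integral_id, intervalIntegral.integral_const, smul_eq_mul]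
  ring

/-- The area of the part of the square `[0,b]²` within distance `s` (along an axis) of the
diagonal. -/
theorem volume_abs_sub_le {b s : ℝ} (hs : 0 ≤ s) (hsb : s ≤ b) :
    volume {x : ℝ × ℝ | x.1 ∈ Icc 0 b ∧ x.2 ∈ Icc 0 b ∧ |x.1 - x.2| ≤ s}
      = ENNReal.ofReal (2 * b * s - s ^ 2) := by
  have hb : 0 ≤ b := hs.trans hsb
  have hm : MeasurableSet {x : ℝ × ℝ | x.1 ∈ Icc 0 b ∧ x.2 ∈ Icc 0 b ∧ |x.1 - x.2| ≤ s} := by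
    refine IsClosed.measurableSet ?_
    exact (isClosed_Icc.preimage continuous_fst).inter
      ((isClosed_Icc.preimage continuous_snd).inter
        (isClosed_le (f := fun x : ℝ × ℝ => |x.1 - x.2|) (by fun_prop) continuous_const))
  have hc : Continuous fun p : ℝ => min s p + min s (b - p) := by fun_prop
  rw [Measure.volume_eq_prod, Measure.prod_apply hm]
  have e : ∀ p : ℝ, volume (Prod.mk p ⁻¹'
      {x : ℝ × ℝ | x.1 ∈ Icc 0 b ∧ x.2 ∈ Icc 0 b ∧ |x.1 - x.2| ≤ s})
      = (Icc 0 b).indicator (fun p => ENNReal.ofReal (min s p + min s (b - p))) p := by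
    intro p
    by_cases hp : p ∈ Icc 0 b
    · rw [indicator_of_mem hp]
      have : Prod.mk p ⁻¹' {x : ℝ × ℝ | x.1 ∈ Icc 0 b ∧ x.2 ∈ Icc 0 b ∧ |x.1 - x.2| ≤ s}
          = Icc (p - min s p) (p + min s (b - p)) := by
        ext q
        simp only [mem_preimage, mem_ofPred_eq, hp, true_and, abs_le]
        constructor
        · rintro ⟨⟨h1, h2⟩, ⟨h3, h4⟩⟩
          have := le_min h4 (show p - q ≤ p by linarith)
          have := le_min (show q - p ≤ s by linarith) (show q - p ≤ b - p by linarith)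
          constructor <;> linarith
        · rintro ⟨h1, h2⟩
          have := min_le_left s p
          have := min_le_right s p
          have := min_le_left s (b - p)
          have := min_le_right s (b - p)
          refine ⟨⟨?_, ?_⟩, ?_, ?_⟩ <;> linarith
      rw [this, Real.volume_Icc]
      congr 1
      ring
    · rw [indicator_of_notMem hp]
      have : Prod.mk p ⁻¹' {x : ℝ × ℝ | x.1 ∈ Icc 0 b ∧ x.2 ∈ Icc 0 b ∧ |x.1 - x.2| ≤ s}
          = ∅ := by
        ext q
        simp only [mem_preimage, mem_ofPred_eq, hp, false_and, mem_empty_iff_false]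
      rw [this, measure_empty]
  simp_rw [e]
  rw [lintegral_indicator measurableSet_Icc, ← ofReal_integral_eq_lintegral_ofReal
    (hc.integrableOn_Icc) ?_, integral_Icc_eq_integral_Ioc,
    ← intervalIntegral.integral_of_le hb]
  · have hi : Continuous fun p : ℝ => min s p := by fun_prop
    have hi' : Continuous fun p : ℝ => min s (b - p) := by fun_prop
    rw [intervalIntegral.integral_add (hi.intervalIntegrable _ _) (hi'.intervalIntegrable _ _),
      intervalIntegral.integral_comp_sub_left (fun p => min s p) b, sub_self, sub_zero,
      integral_min_left hs hsb]
    congr 1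
    ring
  · filter_upwards [ae_restrict_mem measurableSet_Icc] with p hp
    exact add_nonneg (le_min hs hp.1) (le_min hs (sub_nonneg.2 hp.2))

/-- An even function of the difference of two points of `[0,a]` integrates against the triangular
density of that difference. -/
theorem integral_integral_even_sub {h : ℝ → ℝ} (hc : Continuous h) (he : ∀ x, h (-x) = h x)
    (a : ℝ) :
    ∫ p in (0:ℝ)..a, ∫ q in (0:ℝ)..a, h (p - q) = 2 * ∫ u in (0:ℝ)..a, (a - u) * h u := by
  set H : ℝ → ℝ := fun x => ∫ u in (0:ℝ)..x, h u with hH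
  have hd : ∀ x, HasDerivAt H (h x) x := fun x =>
    intervalIntegral.integral_hasDerivAt_right (hc.intervalIntegrable _ _)
      (hc.stronglyMeasurableAtFilter _ _) hc.continuousAt
  have hHc : Continuous H := continuous_iff_continuousAt.2 fun x => (hd x).continuousAt
  have hodd : ∀ x, H (-x) = -H x := by
    intro x
    have := intervalIntegral.integral_comp_neg (a := 0) (b := x) h
    simp only [he, neg_zero] at this
    rw [hH]
    simp only
    rw [this, intervalIntegral.integral_symm]
  have hin : ∀ p, ∫ q in (0:ℝ)..a, h (p - q) = H p + H (a - p) := by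
    intro p
    rw [intervalIntegral.integral_comp_sub_left h p, sub_zero,
      ← intervalIntegral.integral_interval_sub_left (hc.intervalIntegrable 0 p)
        (hc.intervalIntegrable 0 (p - a))]
    have := hodd (a - p)
    rw [neg_sub] at this
    change H p - H (p - a) = _
    rw [this]
    ring
  simp_rw [hin]
  have hc2 : Continuous fun p => H (a - p) := by fun_prop
  rw [intervalIntegral.integral_add (hHc.intervalIntegrable _ _) (hc2.intervalIntegrable _ _),
    intervalIntegral.integral_comp_sub_left H a, sub_self, sub_zero,
    intervalIntegral.integral_mul_deriv_eq_deriv_mul (u := fun u => a - u) (u' := fun _ => -1)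
      (v := H) (fun x _ => by simpa using (hasDerivAt_id x).const_sub a) (fun x _ => hd x)
      (continuous_const.intervalIntegrable _ _) (hc.intervalIntegrable _ _)]
  have h0 : H 0 = 0 := by simp [hH]
  simp only [h0, neg_mul, one_mul, intervalIntegral.integral_neg]
  ring

/-- The measure of the set of pairs of points of `[0,a] × [0,b]` at distance at most `t`, as an
integral over the absolute difference of the first coordinates. -/
theorem volume_dist_le_eq_integral {a b t : ℝ} (ha : 0 ≤ a) (hb : 0 ≤ b) (ht : 0 ≤ t) :
    volume {PQ : EuclideanSpace ℝ (Fin 2) × EuclideanSpace ℝ (Fin 2) |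
        (PQ.1 0 ∈ Icc 0 a ∧ PQ.1 1 ∈ Icc 0 b) ∧ (PQ.2 0 ∈ Icc 0 a ∧ PQ.2 1 ∈ Icc 0 b) ∧
          ‖PQ.1 - PQ.2‖ ≤ t}
      = ENNReal.ofReal (2 * ∫ u in (0:ℝ)..a, (a - u) *
          (2 * b * min b (√(t ^ 2 - u ^ 2)) - min b (√(t ^ 2 - u ^ 2)) ^ 2)) := by
  set s : ℝ → ℝ := fun u => min b (√(t ^ 2 - u ^ 2)) with hs
  set h : ℝ → ℝ := fun u => 2 * b * s u - s u ^ 2 with hh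
  have hs0 : ∀ u, 0 ≤ s u := fun u => le_min hb (Real.sqrt_nonneg _)
  have hsb : ∀ u, s u ≤ b := fun u => min_le_left _ _
  have hsc : Continuous s := by fun_prop
  have hhc : Continuous h := by fun_prop
  have hh0 : ∀ u, 0 ≤ h u := fun u => by
    have := mul_nonneg (hs0 u) (sub_nonneg.2 (hsb u))
    have := mul_nonneg (hs0 u) hb
    simp only [hh]
    nlinarith
  have hhe : ∀ u, h (-u) = h u := fun u => by simp [hh, hs]
  set S : Set ((ℝ × ℝ) × (ℝ × ℝ)) := {z | z.1 ∈ Icc 0 a ×ˢ Icc 0 a ∧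
    z.2.1 ∈ Icc 0 b ∧ z.2.2 ∈ Icc 0 b ∧ (z.1.1 - z.1.2) ^ 2 + (z.2.1 - z.2.2) ^ 2 ≤ t ^ 2}
    with hS
  have hSm : MeasurableSet S := by
    refine IsClosed.measurableSet ?_
    exact ((isClosed_Icc.prod isClosed_Icc).preimage continuous_fst).inter
      ((isClosed_Icc.preimage (continuous_fst.comp continuous_snd)).inter
        ((isClosed_Icc.preimage (continuous_snd.comp continuous_snd)).inter
          (isClosed_le (f := fun z : (ℝ × ℝ) × (ℝ × ℝ) =>
            (z.1.1 - z.1.2) ^ 2 + (z.2.1 - z.2.2) ^ 2) (by fun_prop) continuous_const)))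
  have hT : {PQ : EuclideanSpace ℝ (Fin 2) × EuclideanSpace ℝ (Fin 2) |
        (PQ.1 0 ∈ Icc 0 a ∧ PQ.1 1 ∈ Icc 0 b) ∧ (PQ.2 0 ∈ Icc 0 a ∧ PQ.2 1 ∈ Icc 0 b) ∧
          ‖PQ.1 - PQ.2‖ ≤ t}
      = {PQ : EuclideanSpace ℝ (Fin 2) × EuclideanSpace ℝ (Fin 2) |
          ((PQ.1 0, PQ.2 0), (PQ.1 1, PQ.2 1)) ∈ S} := by
    ext PQ
    have : ‖PQ.1 - PQ.2‖ ≤ t ↔ (PQ.1 0 - PQ.2 0) ^ 2 + (PQ.1 1 - PQ.2 1) ^ 2 ≤ t ^ 2 := by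
      rw [EuclideanSpace.norm_eq, Real.sqrt_le_left ht, Fin.sum_univ_two]
      simp
    simp only [mem_ofPred_eq, hS, mem_prod, this]
    tauto
  have hfib : ∀ x : ℝ × ℝ, volume (Prod.mk x ⁻¹' S)
      = (Icc 0 a ×ˢ Icc 0 a).indicator (fun x => ENNReal.ofReal (h (x.1 - x.2))) x := by
    intro x
    by_cases hx : x ∈ Icc 0 a ×ˢ Icc 0 a
    · rw [indicator_of_mem hx, ← volume_abs_sub_le (hs0 _) (hsb _)]
      rcases le_or_gt ((x.1 - x.2) ^ 2) (t ^ 2) with hxt | hxt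
      · congr 1
        ext y
        simp only [hS, mem_preimage, mem_ofPred_eq, hx, true_and]
        refine and_congr_right fun h1 => and_congr_right fun h2 => ?_
        have h3 : |y.1 - y.2| ≤ b := by
          rw [abs_le]
          constructor <;> linarith [h1.1, h1.2, h2.1, h2.2]
        rw [hs, le_min_iff, Real.le_sqrt (abs_nonneg _) (sub_nonneg.2 hxt), sq_abs]
        constructor
        · intro h4
          exact ⟨h3, by linarith⟩
        · intro h4
          linarith [h4.2]
      · have h1 : Prod.mk x ⁻¹' S = ∅ := by
          ext y
          simp only [hS, mem_preimage, mem_ofPred_eq, mem_empty_iff_false, iff_false, not_and,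
            not_le]
          intros
          nlinarith [sq_nonneg (y.1 - y.2)]
        have h2 : s (x.1 - x.2) = 0 := by
          simp only [hs]
          rw [Real.sqrt_eq_zero_of_nonpos (by linarith), min_eq_right hb]
        rw [h1, volume_abs_sub_le (hs0 _) (hsb _), h2]
        simp
    · rw [indicator_of_notMem hx]
      have : Prod.mk x ⁻¹' S = ∅ := by
        ext y
        simp only [hS, mem_preimage, mem_ofPred_eq, hx, false_and, mem_empty_iff_false]
      rw [this, measure_empty]
  have hint : IntegrableOn (fun x : ℝ × ℝ => h (x.1 - x.2)) (Icc 0 a ×ˢ Icc 0 a)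
      (volume : Measure (ℝ × ℝ)) :=
    (by fun_prop : Continuous fun x : ℝ × ℝ => h (x.1 - x.2)).continuousOn.integrableOn_compact
      (isCompact_Icc.prod isCompact_Icc)
  rw [hT, volume_euclideanSpace_prod_eq S hSm, Measure.volume_eq_prod, Measure.prod_apply hSm]
  simp_rw [hfib]
  rw [lintegral_indicator (measurableSet_Icc.prod measurableSet_Icc),
    ← ofReal_integral_eq_lintegral_ofReal hint (Filter.Eventually.of_forall fun x => hh0 _),
    Measure.volume_eq_prod, setIntegral_prod _ hint]
  simp_rw [integral_Icc_eq_integral_Ioc, ← intervalIntegral.integral_of_le ha]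
  rw [integral_integral_even_sub hhc hhe]

/-- The quarter-circle part of the integrand has an elementary primitive. -/
theorem integral_sub_mul_sqrt {a b t x₀ x₁ : ℝ} (ht : 0 < t) (h0 : 0 ≤ x₀) (h01 : x₀ ≤ x₁)
    (h1 : x₁ ≤ t) (F : ℝ → ℝ)
    (hF : ∀ x, F x = b * (a * (x * √(t ^ 2 - x ^ 2) + t ^ 2 * arcsin (x / t))
      + 2 / 3 * √(t ^ 2 - x ^ 2) ^ 3)
      - (a * t ^ 2 * x - a * x ^ 3 / 3 - t ^ 2 * x ^ 2 / 2 + x ^ 4 / 4)) :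
    ∫ u in x₀..x₁, (a - u) * (2 * b * √(t ^ 2 - u ^ 2) - √(t ^ 2 - u ^ 2) ^ 2)
      = F x₁ - F x₀ := by
  have hFc : Continuous F := by
    rw [funext hF]
    have := Real.continuous_arcsin
    fun_prop
  refine intervalIntegral.integral_eq_sub_of_hasDerivAt_of_le h01 hFc.continuousOn
    (fun x hx => ?_) (Continuous.intervalIntegrable (by fun_prop) _ _)
  have hx0 : 0 < x := h0.trans_lt hx.1
  have hxt : x < t := hx.2.trans_le h1
  have hpos : 0 < t ^ 2 - x ^ 2 := by nlinarith
  have hr : 0 < √(t ^ 2 - x ^ 2) := Real.sqrt_pos.2 hpos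
  have hr2 : √(t ^ 2 - x ^ 2) ^ 2 = t ^ 2 - x ^ 2 := Real.sq_sqrt hpos.le
  have hq : HasDerivAt (fun x : ℝ => t ^ 2 - x ^ 2) (-(2 * x)) x := by
    simpa using (hasDerivAt_pow 2 x).const_sub (t ^ 2)
  have hsq : HasDerivAt (fun x : ℝ => √(t ^ 2 - x ^ 2)) (-x / √(t ^ 2 - x ^ 2)) x := by
    convert! hq.sqrt hpos.ne' using 1
    field_simp
  have has : HasDerivAt (fun x : ℝ => arcsin (x / t)) (1 / √(t ^ 2 - x ^ 2)) x := by
    have hlt : x / t < 1 := (div_lt_one ht).2 hxt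
    have hgt : -1 < x / t := by linarith [div_pos hx0 ht]
    have := (Real.hasDerivAt_arcsin hgt.ne' hlt.ne).comp x ((hasDerivAt_id x).div_const t)
    convert! this using 1
    have e : 1 - (x / t) ^ 2 = (t ^ 2 - x ^ 2) / t ^ 2 := by field_simp
    rw [e, Real.sqrt_div hpos.le, Real.sqrt_sq ht.le]
    field_simp
  rw [funext hF]
  have hp : HasDerivAt (fun x : ℝ => a * t ^ 2 * x - a * x ^ 3 / 3 - t ^ 2 * x ^ 2 / 2 + x ^ 4 / 4)
      (a * t ^ 2 - a * x ^ 2 - t ^ 2 * x + x ^ 3) x := by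
    have := ((((hasDerivAt_id x).const_mul (a * t ^ 2)).sub
      (((hasDerivAt_pow 3 x).const_mul a).div_const 3)).sub
      (((hasDerivAt_pow 2 x).const_mul (t ^ 2)).div_const 2)).add
      ((hasDerivAt_pow 4 x).div_const 4)
    convert! this using 1
    push_cast
    ring
  have := (((((hasDerivAt_id x).mul hsq).add (has.const_mul (t ^ 2))).const_mul a).add
    ((hsq.pow 3).const_mul (2 / 3))).const_mul b |>.sub hp
  convert! this using 1
  simp only [id]
  generalize √(t ^ 2 - x ^ 2) = r at *
  field_simp
  have ht2 : t ^ 2 = r ^ 2 + x ^ 2 := by linarith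
  simp only [ht2]
  push_cast
  ring

/-- The distribution function of the distance between two uniform random points
in the rectangle `R = [0,a] × [0,b]` (Ghosh's result). -/
theorem distance_distribution_rectangle
    (a b c AR uR : ℝ) (ha : 0 < a) (hab : a ≤ b)
    (hc : c = Real.sqrt (a ^ 2 + b ^ 2))
    (hAR : AR = a * b)
    (huR : uR = 2 * (a + b))
    (R : Set (EuclideanSpace ℝ (Fin 2)))
    (hR : R = {P | P 0 ∈ Set.Icc 0 a ∧ P 1 ∈ Set.Icc 0 b})
    (L₂d : ℝ → ℝ → ℝ)
    (hL₂d : ∀ t r, L₂d t r = (1 / 3) * (t ^ 2 - r ^ 2) ^ ((3:ℝ) / 2)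
      + (r / 2) * (r * Real.sqrt (t ^ 2 - r ^ 2) + t ^ 2 * Real.arcsin (r / t)))
    (HR₁ HR₂ HR₃ : ℝ → ℝ)
    (hHR₁ : ∀ t, HR₁ t = π * AR * t ^ 2 / 2 - uR * t ^ 3 / 3 + t ^ 4 / 4)
    (hHR₂ : ∀ t, HR₂ t = -(a ^ 2 * t ^ 2) / 2 - 2 * b * t ^ 3 / 3 + 2 * b * L₂d t a)
    (hHR₃ : ∀ t, HR₃ t = -((π * AR + c ^ 2) * t ^ 2) / 2 - t ^ 4 / 4
      + 2 * b * L₂d t a + 2 * a * L₂d t b)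
    (JR : ℝ → ℝ)
    (hJR₁ : ∀ t, 0 ≤ t → t < a → JR t = HR₁ t - HR₁ 0)
    (hJR₂ : ∀ t, a ≤ t → t < b → JR t = (HR₁ a - HR₁ 0) + (HR₂ t - HR₂ a))
    (hJR₃ : ∀ t, b ≤ t → t < c → JR t = (HR₁ a - HR₁ 0) + (HR₂ b - HR₂ a)
      + (HR₃ t - HR₃ b)) :
    ∀ t : ℝ,
      (0 ≤ t → t < c →
        volume {PQ : EuclideanSpace ℝ (Fin 2) × EuclideanSpace ℝ (Fin 2) |
            PQ.1 ∈ R ∧ PQ.2 ∈ R ∧ ‖PQ.1 - PQ.2‖ ≤ t}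
          = ENNReal.ofReal (2 * JR t)) ∧
      (c ≤ t →
        volume {PQ : EuclideanSpace ℝ (Fin 2) × EuclideanSpace ℝ (Fin 2) |
            PQ.1 ∈ R ∧ PQ.2 ∈ R ∧ ‖PQ.1 - PQ.2‖ ≤ t}
          = ENNReal.ofReal ((a * b) ^ 2)) := by
  intro t
  have hb : 0 < b := ha.trans_le hab
  have hc2 : c ^ 2 = a ^ 2 + b ^ 2 := by rw [hc, Real.sq_sqrt (by positivity)]
  have hc0 : 0 ≤ c := hc ▸ Real.sqrt_nonneg _
  have hbc : b < c := by nlinarith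
  have hvol := fun ht : 0 ≤ t => volume_dist_le_eq_integral ha.le hb.le ht
  have hcube : ∀ x : ℝ, 0 ≤ x → x ^ ((3:ℝ) / 2) = √x ^ 3 := fun x hx => by
    rw [Real.sqrt_eq_rpow, ← Real.rpow_natCast, ← Real.rpow_mul hx]
    norm_num
  subst hR
  have hG : Continuous fun u : ℝ => (a - u) *
      (2 * b * min b (√(t ^ 2 - u ^ 2)) - min b (√(t ^ 2 - u ^ 2)) ^ 2) := by fun_prop
  have hLself : ∀ r, 0 < r → L₂d r r = π * r ^ 3 / 4 := fun r hr => by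
    rw [hL₂d, hcube _ (by simp), div_self hr.ne', arcsin_one]
    simp
    ring
  refine ⟨fun ht0 htc => ?_, fun hct => ?_⟩
  · refine (hvol ht0).trans (congrArg _ ?_)
    congr 1
    rcases lt_or_ge t b with htb | hbt
    · have hmin : ∀ u : ℝ, min b (√(t ^ 2 - u ^ 2)) = √(t ^ 2 - u ^ 2) := fun u =>
        min_eq_right ((Real.sqrt_le_left hb.le).2 (by nlinarith [sq_nonneg u]))
      simp only [hmin] at hG ⊢
      rcases lt_or_ge t a with hta | hat
      · rw [← intervalIntegral.integral_add_adjacent_intervals (b := t)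
          (hG.intervalIntegrable _ _) (hG.intervalIntegrable _ _)]
        have h2 : ∫ u in t..a, (a - u) * (2 * b * √(t ^ 2 - u ^ 2) - √(t ^ 2 - u ^ 2) ^ 2)
            = ∫ u in t..a, (0:ℝ) := by
          refine intervalIntegral.integral_congr fun u hu => ?_
          rw [uIcc_of_le hta.le] at hu
          simp [Real.sqrt_eq_zero_of_nonpos (show t ^ 2 - u ^ 2 ≤ 0 by nlinarith [hu.1])]
        rw [h2, hJR₁ t ht0 hta, hHR₁, hHR₁, hAR, huR]
        rcases ht0.eq_or_lt with rfl | htpos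
        · simp
        · rw [integral_sub_mul_sqrt htpos le_rfl ht0 le_rfl _ (fun _ => rfl)]
          simp only [sub_self, Real.sqrt_zero, div_self htpos.ne', arcsin_one, zero_div,
            arcsin_zero, ne_eq, OfNat.ofNat_ne_zero, not_false_eq_true, zero_pow, sub_zero,
            Real.sqrt_sq ht0, intervalIntegral.integral_zero]
          ring
      · have htpos : 0 < t := ha.trans_le hat
        rw [integral_sub_mul_sqrt htpos le_rfl ha.le hat _ (fun _ => rfl), hJR₂ t hat htb,
          hHR₁, hHR₁, hHR₂, hHR₂, hLself a ha, hL₂d, hcube _ (by nlinarith), hAR, huR]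
        simp only [zero_div, arcsin_zero, ne_eq, OfNat.ofNat_ne_zero, not_false_eq_true, zero_pow,
          sub_zero, Real.sqrt_sq ht0]
        ring
    · have htpos : 0 < t := hb.trans_le hbt
      have hat : a ≤ t := hab.trans hbt
      set x₀ := √(t ^ 2 - b ^ 2) with hx₀
      have hx₀0 : 0 ≤ x₀ := Real.sqrt_nonneg _
      have hx₀2 : x₀ ^ 2 = t ^ 2 - b ^ 2 := Real.sq_sqrt (by nlinarith)
      have hx₀a : x₀ ≤ a := by
        rw [hx₀, Real.sqrt_le_left ha.le]
        nlinarith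
      rw [← intervalIntegral.integral_add_adjacent_intervals (b := x₀)
        (hG.intervalIntegrable _ _) (hG.intervalIntegrable _ _)]
      have h1 : ∫ u in (0:ℝ)..x₀, (a - u) *
            (2 * b * min b (√(t ^ 2 - u ^ 2)) - min b (√(t ^ 2 - u ^ 2)) ^ 2)
          = ∫ u in (0:ℝ)..x₀, (a - u) * b ^ 2 := by
        refine intervalIntegral.integral_congr fun u hu => ?_
        rw [uIcc_of_le hx₀0] at hu
        have : b ≤ √(t ^ 2 - u ^ 2) := (Real.le_sqrt' hb).2 (by nlinarith [hu.1, hu.2])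
        simp only [min_eq_left this]
        ring
      have h2 : ∫ u in x₀..a, (a - u) *
            (2 * b * min b (√(t ^ 2 - u ^ 2)) - min b (√(t ^ 2 - u ^ 2)) ^ 2)
          = ∫ u in x₀..a, (a - u) * (2 * b * √(t ^ 2 - u ^ 2) - √(t ^ 2 - u ^ 2) ^ 2) := by
        refine intervalIntegral.integral_congr fun u hu => ?_
        rw [uIcc_of_le hx₀a] at hu
        have : √(t ^ 2 - u ^ 2) ≤ b := (Real.sqrt_le_left hb.le).2 (by nlinarith [hu.1, hu.2])
        simp only [min_eq_right this]
      have hasin : arcsin (x₀ / t) = π / 2 - arcsin (b / t) := by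
        rw [← arccos_eq_pi_div_two_sub_arcsin, arccos_eq_arcsin (by positivity)]
        congr 1
        rw [show 1 - (b / t) ^ 2 = (t ^ 2 - b ^ 2) / t ^ 2 by field_simp,
          Real.sqrt_div' _ (by positivity), Real.sqrt_sq ht0]
      have hsx : √(t ^ 2 - x₀ ^ 2) = b := by
        rw [hx₀2, sub_sub_cancel, Real.sqrt_sq hb.le]
      rw [h1, h2, intervalIntegral.integral_mul_const, intervalIntegral.integral_sub
        (by simp) (by simp), intervalIntegral.integral_const, integral_id,
        integral_sub_mul_sqrt htpos hx₀0 hx₀a hat _ (fun _ => rfl), hJR₃ t hbt htc,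
        hHR₁, hHR₁, hHR₂, hHR₂, hHR₃, hHR₃, hLself a ha, hLself b hb, hsx, hasin, hc2,
        hL₂d t a, hL₂d t b, hcube _ (by nlinarith), hcube _ (by nlinarith), ← hx₀, hAR, huR]
      simp only [smul_eq_mul, sub_zero]
      have hx3 : x₀ ^ 3 = x₀ * (t ^ 2 - b ^ 2) := by rw [pow_succ, hx₀2, mul_comm]
      have hx4 : x₀ ^ 4 = (t ^ 2 - b ^ 2) ^ 2 := by rw [← hx₀2]; ring
      rw [hx4, hx3, hx₀2]
      ring
  · have ht0 : 0 ≤ t := hc0.trans hct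
    refine (hvol ht0).trans (congrArg _ ?_)
    have h1 : ∫ u in (0:ℝ)..a, (a - u) *
          (2 * b * min b (√(t ^ 2 - u ^ 2)) - min b (√(t ^ 2 - u ^ 2)) ^ 2)
        = ∫ u in (0:ℝ)..a, (a - u) * b ^ 2 := by
      refine intervalIntegral.integral_congr fun u hu => ?_
      rw [uIcc_of_le ha.le] at hu
      have : b ≤ √(t ^ 2 - u ^ 2) := (Real.le_sqrt' hb).2 (by nlinarith [hu.1, hu.2])
      simp only [min_eq_left this]
      ring
    rw [h1, intervalIntegral.integral_mul_const, intervalIntegral.integral_sub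
        (by simp) (by simp), intervalIntegral.integral_const, integral_id, smul_eq_mul]
    ring
end

section
/- For every φ with π/2 ≤ φ < π/2 + α and every s with h ≤ s < a, the one-dimensional Lebesgue measure of the set {p ∈ ℝ : ℓ(p,φ) ∩ T ≠ ∅ and H¹(ℓ(p,φ) ∩ T) ≤ s} equals b₁(s,φ) + b₃(s,φ), where b₁(s,φ) = (s/2)·(sin(2φ−α) + sin α)/cos α and b₃(s,φ) = −(s/2)·sin 2φ. (That is, the lines of direction angle φ producing a chord of length at most s form two strips of breadths b₁(s,φ) and b₃(s,φ).) -/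
open Real MeasureTheory

/-- The map parametrizing a line of the Euclidean plane by arc length is an isometry. -/
lemma isometry_planar_line (x₀ u v : ℝ) (huv : u ^ 2 + v ^ 2 = 1) :
    Isometry (fun r : ℝ => (!₂[x₀ - r * u, r * v] : EuclideanSpace ℝ (Fin 2))) := by
  refine Isometry.of_dist_eq fun r t => ?_
  rw [EuclideanSpace.dist_eq, Fin.sum_univ_two, Real.dist_eq r t, ← Real.sqrt_sq_eq_abs]
  congr 1
  simp only [Real.dist_eq, sq_abs, Matrix.cons_val_zero, Matrix.cons_val_one]
  linear_combination (r - t) ^ 2 * huv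

/-- When the segment `{r | 0 ≤ r, r * M ≤ q, r * N ≤ K}` is nonempty and of length at most `s`. -/
lemma nonempty_and_volume_segment_le_iff {M N q K s : ℝ} (hM : 0 ≤ M) (hN : 0 < N) (hs : 0 < s)
    (hq : q ≠ 0) :
    ({r : ℝ | 0 ≤ r ∧ r * M ≤ q ∧ r * N ≤ K}.Nonempty ∧
      volume {r : ℝ | 0 ≤ r ∧ r * M ≤ q ∧ r * N ≤ K} ≤ ENNReal.ofReal s) ↔
      0 ≤ q ∧ 0 ≤ K ∧ (q ≤ s * M ∨ K ≤ s * N) := by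
  constructor
  · rintro ⟨⟨r, hr, hrq, hrK⟩, hvol⟩
    refine ⟨(mul_nonneg hr hM).trans hrq, (mul_nonneg hr hN.le).trans hrK, ?_⟩
    by_contra! hlt
    have hev : ∀ᶠ t in nhdsWithin s (Set.Ioi s), t * M < q ∧ t * N < K := by
      refine Filter.Eventually.filter_mono nhdsWithin_le_nhds (Filter.Eventually.and ?_ ?_)
      · exact (continuous_mul_const M).continuousAt.eventually_lt continuousAt_const hlt.1
      · exact (continuous_mul_const N).continuousAt.eventually_lt continuousAt_const hlt.2
    obtain ⟨t, ⟨htq, htK⟩, hst⟩ := (hev.and self_mem_nhdsWithin).exists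
    have hst' : s < t := hst
    have hsub : Set.Icc 0 t ⊆ {r : ℝ | 0 ≤ r ∧ r * M ≤ q ∧ r * N ≤ K} := fun r hr =>
      ⟨hr.1, (mul_le_mul_of_nonneg_right hr.2 hM).trans htq.le,
        (mul_le_mul_of_nonneg_right hr.2 hN.le).trans htK.le⟩
    have hle := (measure_mono hsub).trans hvol
    rw [Real.volume_Icc, sub_zero, ENNReal.ofReal_le_ofReal_iff hs.le] at hle
    linarith
  · rintro ⟨hq0, hK0, hor⟩
    refine ⟨⟨0, le_rfl, by simpa, by simpa⟩, ?_⟩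
    have hsub : {r : ℝ | 0 ≤ r ∧ r * M ≤ q ∧ r * N ≤ K} ⊆ Set.Icc 0 s := by
      rintro r ⟨hr, hrq, hrK⟩
      refine ⟨hr, ?_⟩
      rcases hor with h | h
      · have hM' : 0 < M := by
          refine hM.lt_of_ne fun h0 => hq (le_antisymm ?_ hq0)
          simpa [← h0] using h
        exact le_of_mul_le_mul_right (hrq.trans h) hM'
      · exact le_of_mul_le_mul_right (hrK.trans h) hN
    simpa using measure_mono (μ := volume) hsub

/-- The chord cut from the triangle by a line is the isometric image of an explicit segment. -/
lemma chord_eq_image {a b u v p : ℝ} (hv : 0 < v) :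
    ({P | -(P 0) * v + P 1 * -u = p} ∩
        {P | 0 ≤ P 0 ∧ 0 ≤ P 1 ∧ b * P 0 + a * P 1 ≤ a * b} : Set (EuclideanSpace ℝ (Fin 2))) =
      (fun r : ℝ => (!₂[-p / v - r * u, r * v] : EuclideanSpace ℝ (Fin 2))) ''
        {r | 0 ≤ r ∧ r * (u * v) ≤ -p ∧ r * (v * (a * v - b * u)) ≤ b * (a * v + p)} := by
  ext P
  simp only [Set.mem_inter_iff, Set.mem_ofPred_eq, Set.mem_image]
  constructor
  · rintro ⟨hp, h0, h1, h2⟩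
    have hy : P 1 / v * v = P 1 := div_mul_cancel₀ _ hv.ne'
    refine ⟨P 1 / v, ⟨by positivity, ?_, ?_⟩, ?_⟩
    · have : P 1 / v * (u * v) = P 1 * u := by linear_combination u * hy
      nlinarith [mul_nonneg h0 hv.le]
    · have : P 1 / v * (v * (a * v - b * u)) = P 1 * (a * v - b * u) := by
        linear_combination (a * v - b * u) * hy
      rw [this, ← hp]
      nlinarith [mul_le_mul_of_nonneg_right h2 hv.le]
    · ext i
      fin_cases i
      · simp only [Fin.zero_eta, Matrix.cons_val_zero]
        field_simp
        linarith
      · simpa using hy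
  · rintro ⟨r, ⟨hr, hr1, hr2⟩, rfl⟩
    simp only [Matrix.cons_val_zero, Matrix.cons_val_one]
    have hx : (-p / v - r * u) * v = -p - r * (u * v) := by
      field_simp
    refine ⟨by linarith, ?_, by positivity, ?_⟩
    · exact nonneg_of_mul_nonneg_left (by rw [hx]; linarith) hv
    · refine le_of_mul_le_mul_right ?_ hv
      linear_combination hr2 + b * hx

/-- Total breadth of the strips of lines with unit direction `(-u, v)` cutting short chords. -/
lemma volume_short_chords {a b u v s : ℝ} (hb : 0 < b) (hu : 0 ≤ u) (hv : 0 < v)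
    (huv : u ^ 2 + v ^ 2 = 1) (hd : 0 < a * v - b * u) (hs : 0 < s) (hsb : s < b) :
    volume {p : ℝ | ({P | -(P 0) * v + P 1 * -u = p} ∩
        {P | 0 ≤ P 0 ∧ 0 ≤ P 1 ∧ b * P 0 + a * P 1 ≤ a * b} :
          Set (EuclideanSpace ℝ (Fin 2))).Nonempty ∧
        μH[1] ({P | -(P 0) * v + P 1 * -u = p} ∩
          {P | 0 ≤ P 0 ∧ 0 ≤ P 1 ∧ b * P 0 + a * P 1 ≤ a * b} :
          Set (EuclideanSpace ℝ (Fin 2))) ≤ ENNReal.ofReal s} =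
      ENNReal.ofReal (s * (v * (a * v - b * u)) / b + s * (u * v)) := by
  have hv1 : v ≤ 1 := by nlinarith
  have hM : 0 ≤ u * v := by positivity
  have hN : 0 < v * (a * v - b * u) := by positivity
  have hav : 0 < a * v := by nlinarith
  have hsv : s * v < b := by nlinarith
  have hNb : s * (v * (a * v - b * u)) / b < a * v - b * u := by
    rw [div_lt_iff₀ hb]
    nlinarith
  have hMb : s * (u * v) ≤ b * u := by nlinarith
  simp_rw [chord_eq_image hv, Set.image_nonempty,
    (isometry_planar_line _ u v huv).hausdorffMeasure_image (Or.inl zero_le_one),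
    hausdorffMeasure_real]
  have hset : {p : ℝ | {r : ℝ | 0 ≤ r ∧ r * (u * v) ≤ -p ∧
          r * (v * (a * v - b * u)) ≤ b * (a * v + p)}.Nonempty ∧
        volume {r : ℝ | 0 ≤ r ∧ r * (u * v) ≤ -p ∧
          r * (v * (a * v - b * u)) ≤ b * (a * v + p)} ≤ ENNReal.ofReal s} =ᵐ[volume]
      (Set.Icc (-(a * v)) (-(a * v) + s * (v * (a * v - b * u)) / b) ∪
        Set.Icc (-(s * (u * v))) 0 : Set ℝ) := by
    have hne : ∀ᵐ p : ℝ, p ≠ 0 := by simp [ae_iff]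
    filter_upwards [hne] with p hp
    refine propext ((nonempty_and_volume_segment_le_iff hM hN hs (neg_ne_zero.2 hp)).trans ?_)
    have hK : b * (a * v + p) ≤ s * (v * (a * v - b * u)) ↔
        p ≤ -(a * v) + s * (v * (a * v - b * u)) / b := by
      rw [← sub_le_iff_le_add', le_div_iff₀ hb, sub_neg_eq_add, mul_comm b, add_comm p]
    have hK0 : 0 ≤ b * (a * v + p) ↔ -(a * v) ≤ p := by
      rw [mul_nonneg_iff_of_pos_left hb, neg_le_iff_add_nonneg']
    change _ ↔ (_ ∧ _) ∨ (_ ∧ _)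
    rw [hK, hK0]
    constructor
    · rintro ⟨h1, h2, h | h⟩
      · exact Or.inr ⟨by linarith, by linarith⟩
      · exact Or.inl ⟨h2, h⟩
    · have hbu : 0 ≤ b * u := by positivity
      rintro (⟨h1, h2⟩ | ⟨h1, h2⟩)
      · exact ⟨by linarith, h1, Or.inr h2⟩
      · exact ⟨by linarith, by linarith, Or.inl (by linarith)⟩
  rw [measure_congr hset, measure_union _ measurableSet_Icc, Real.volume_Icc, Real.volume_Icc,
    ← ENNReal.ofReal_add]
  · congr 1
    ring
  · rw [add_sub_cancel_left]
    positivity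
  · rw [sub_neg_eq_add, zero_add]
    positivity
  · rw [Set.disjoint_left]
    rintro p ⟨_, h1⟩ ⟨h2, _⟩
    linarith


/-- For directions `π/2 ≤ φ < π/2 + α` and chord lengths `h ≤ s < a`, the lines with
direction angle `φ` meeting the triangle `T` in a chord of length at most `s` form a set
of signed distances `p` of one-dimensional Lebesgue measure `b₁(s,φ) + b₃(s,φ)`. -/
theorem strip_breadths_case_d
    (a b c α h : ℝ) (ha : 0 < a) (hab : a ≤ b)
    (hc : c = Real.sqrt (a ^ 2 + b ^ 2))
    (hα : α = Real.arctan (a / b))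
    (hh : h = a * b / c)
    (T : Set (EuclideanSpace ℝ (Fin 2)))
    (hT : T = {P | 0 ≤ P 0 ∧ 0 ≤ P 1 ∧ b * P 0 + a * P 1 ≤ a * b})
    (line : ℝ → ℝ → Set (EuclideanSpace ℝ (Fin 2)))
    (hline : ∀ p φ, line p φ = {P | -(P 0) * Real.sin φ + P 1 * Real.cos φ = p}) :
    ∀ φ : ℝ, π / 2 ≤ φ → φ < π / 2 + α →
      ∀ s : ℝ, h ≤ s → s < a →
        volume {p : ℝ | (line p φ ∩ T).Nonempty ∧
            μH[1] (line p φ ∩ T) ≤ ENNReal.ofReal s}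
          = ENNReal.ofReal ((s / 2) * (Real.sin (2 * φ - α) + Real.sin α) / Real.cos α
            + -(s / 2) * Real.sin (2 * φ)) := by
  intro φ hφ1 hφ2 s hs1 hs2
  have hb : 0 < b := ha.trans_le hab
  have hs : 0 < s := by
    refine lt_of_lt_of_le ?_ hs1
    rw [hh, hc]
    positivity
  have hα2 : α < π / 2 := hα ▸ Real.arctan_lt_pi_div_two _
  have hα0 : 0 < α := hα ▸ Real.arctan_pos.2 (by positivity)
  have hcosα : 0 < Real.cos α := Real.cos_pos_of_mem_Ioo ⟨by linarith, hα2⟩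
  have htan : Real.sin α = a / b * Real.cos α := by
    rw [← Real.tan_mul_cos hcosα.ne', hα, Real.tan_arctan]
  have hu : 0 ≤ -Real.cos φ :=
    neg_nonneg.2 (Real.cos_nonpos_of_pi_div_two_le_of_le hφ1 (by linarith))
  have hv : 0 < Real.sin φ := Real.sin_pos_of_pos_of_lt_pi (by linarith) (by linarith)
  have huv : (-Real.cos φ) ^ 2 + Real.sin φ ^ 2 = 1 := by
    rw [neg_sq, Real.cos_sq_add_sin_sq]
  have hd : 0 < a * Real.sin φ - b * -Real.cos φ := by
    have hcos : 0 < Real.cos (φ - α) := Real.cos_pos_of_mem_Ioo ⟨by linarith, by linarith⟩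
    rw [Real.cos_sub, htan] at hcos
    have : a * Real.sin φ - b * -Real.cos φ =
        b / Real.cos α * (Real.cos φ * Real.cos α + Real.sin φ * (a / b * Real.cos α)) := by
      field_simp
      ring
    rw [this]
    positivity
  have hvol := volume_short_chords hb hu hv huv hd hs (hs2.trans_le hab)
  simp only [neg_neg] at hvol
  simp only [hline, hT]
  rw [hvol]
  congr 1
  rw [Real.sin_sub, htan, Real.sin_two_mul, Real.cos_two_mul']
  field_simp
  linear_combination a * (Real.sin_sq_add_cos_sq φ)
end
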